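/- Let τ, t*, T₂ be real numbers with 1 < τ < 2, 2 < t* < 3, 3 < T₂ < 4 satisfying τ = T₂ − 2·cos((τ − 1)/2), t* = (T₂ + 1)/2, and T₂ = t* + 2·cos((2t* + τ)/4 − 3/4) (numerically τ ≈ 1.7815, t* ≈ 2.3154, T₂ ≈ 3.6307). Then, in the priority evacuation model with 2 servants, for every trajectories Q, S₁, S₂ and every real B, if they evacuate the queen in time B then B ≥ T₂. -/

import Mathlib

open Real Set MeasureTheory
open scoped RealInnerProductSpace

noncomputable section

abbrev Plane : Type := EuclideanSpace ℝ (Fin 2)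

/-- The point of the unit circle at angle `θ`. -/
def circlePt (θ : ℝ) : Plane := (WithLp.equiv 2 (Fin 2 → ℝ)).symm ![Real.cos θ, Real.sin θ]

/-- A trajectory in the priority evacuation model: a `1`-Lipschitz function on `[0, ∞)`
starting at the origin. -/
def IsTraj (f : ℝ → Plane) : Prop :=
  LipschitzOnWith 1 f (Set.Ici 0) ∧ f 0 = 0

/-- The first-visit time of the point `p` by the queen `Q` or one of the servants `S i`. -/
def visitTime {n : ℕ} (Q : ℝ → Plane) (S : Fin n → ℝ → Plane) (p : Plane) : ℝ :=
  sInf {t : ℝ | 0 ≤ t ∧ (Q t = p ∨ ∃ i, S i t = p)}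

/-- The trajectories `Q` (queen) and `S 0, …, S (n-1)` (servants) evacuate the queen in
time `B`: every point of the unit circle is visited, and the first-visit time plus the
distance from the queen (at that moment) to the point is at most `B`. -/
def Evacuates {n : ℕ} (Q : ℝ → Plane) (S : Fin n → ℝ → Plane) (B : ℝ) : Prop :=
  ∀ p : Plane, ‖p‖ = 1 →
    (∃ t : ℝ, 0 ≤ t ∧ (Q t = p ∨ ∃ i, S i t = p)) ∧
    visitTime Q S p + ‖Q (visitTime Q S p) - p‖ ≤ B

/-- The set of angles in `[0, 2π)` whose circle point is visited by the queen at some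
time in `Tset`; its Lebesgue measure is the arc measure of the queen-explored set. -/
def queenArc (Q : ℝ → Plane) (Tset : Set ℝ) : Set ℝ :=
  {θ : ℝ | θ ∈ Set.Ico 0 (2 * π) ∧ ∃ s ∈ Tset, Q s = circlePt θ}

theorem norm_circlePt (θ : ℝ) : ‖circlePt θ‖ = 1 := by
  simp [circlePt, EuclideanSpace.norm_eq, Fin.sum_univ_two]

theorem exists_eq_circlePt {p : Plane} (hp : ‖p‖ = 1) : ∃ α, p = circlePt α := by
  have h : p 0 ^ 2 + p 1 ^ 2 = 1 := by
    have := EuclideanSpace.real_norm_sq_eq p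
    rw [hp, Fin.sum_univ_two] at this
    linarith
  have hn : ‖(⟨p 0, p 1⟩ : ℂ)‖ = 1 := by
    rw [← sq_eq_sq₀ (norm_nonneg _) zero_le_one, Complex.sq_norm, Complex.normSq_mk]
    linarith
  have h0 : (⟨p 0, p 1⟩ : ℂ) ≠ 0 := norm_pos_iff.1 (by rw [hn]; exact one_pos)
  refine ⟨Complex.arg ⟨p 0, p 1⟩, ?_⟩
  ext i
  fin_cases i
  · simp [circlePt, Complex.cos_arg h0, hn]
  · simp [circlePt, Complex.sin_arg, hn]

theorem norm_circlePt_sub (a b : ℝ) :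
    ‖circlePt a - circlePt b‖ = 2 * |Real.sin ((a - b) / 2)| := by
  rw [← sq_eq_sq₀ (norm_nonneg _) (by positivity), EuclideanSpace.real_norm_sq_eq, mul_pow, sq_abs,
    Fin.sum_univ_two]
  have h := Real.cos_sq ((a - b) / 2)
  rw [mul_div_cancel₀ _ (two_ne_zero' ℝ)] at h
  have h' := Real.cos_sub a b
  simp only [circlePt, WithLp.equiv_symm_apply, PiLp.sub_apply, Matrix.cons_val_zero,
    Matrix.cons_val_one]
  nlinarith [Real.sin_sq_add_cos_sq ((a - b) / 2), Real.sin_sq_add_cos_sq a,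
    Real.sin_sq_add_cos_sq b]

theorem exists_pos_abs_le_mul_abs_sin {K : ℝ} (hK : 1 < K) :
    ∃ δ, 0 < δ ∧ δ < 1 ∧ ∀ u, |u| ≤ δ → |u| ≤ K * |Real.sin u| := by
  have hlim : Filter.Tendsto Real.sinc (nhds 0) (nhds 1) := by
    simpa using Real.continuous_sinc.tendsto 0
  obtain ⟨ε, hε, h⟩ := Metric.eventually_nhds_iff.1
    (hlim.eventually_const_lt (inv_lt_one_of_one_lt₀ hK))
  refine ⟨min (ε / 2) (1 / 2), by positivity, by linarith [min_le_right (ε / 2) (1 / 2)], ?_⟩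
  intro u hu
  rcases eq_or_ne u 0 with rfl | hu0
  · simp
  have hs := h (y := u) (by
    rw [Real.dist_eq, sub_zero]
    linarith [min_le_left (ε / 2) (1 / 2)])
  rw [Real.sinc_of_ne_zero hu0] at hs
  have hs' := hs.le.trans (le_abs_self _)
  rwa [abs_div, le_div_iff₀ (abs_pos.2 hu0), inv_mul_le_iff₀ (by linarith)] at hs'

/-- On an arc shorter than the circle, short chords span arcs of almost the same length. -/
theorem exists_pos_abs_sub_le_mul_norm_circlePt_sub {K ℓ : ℝ} (hK : 1 < K) (hℓ : ℓ < 2 * π) :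
    ∃ η, 0 < η ∧ ∀ a b, |a - b| ≤ ℓ → ‖circlePt a - circlePt b‖ < η →
      |a - b| ≤ K * ‖circlePt a - circlePt b‖ := by
  obtain ⟨δ, hδ, hδ1, h⟩ := exists_pos_abs_le_mul_abs_sin hK
  have hπ := Real.pi_gt_three
  set c := min (π - ℓ / 2) δ with hc
  have hc0 : 0 < c := lt_min (by linarith) hδ
  have hcδ : c ≤ δ := min_le_right _ _
  have hcℓ : c ≤ π - ℓ / 2 := min_le_left _ _
  refine ⟨2 * Real.sin c, by linarith [Real.sin_pos_of_pos_of_lt_pi hc0 (by linarith)], ?_⟩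
  intro a b hab hn
  rw [norm_circlePt_sub] at hn ⊢
  have habs : |(a - b) / 2| = |a - b| / 2 := by rw [abs_div, abs_two]
  have hsin : |Real.sin ((a - b) / 2)| = Real.sin (|a - b| / 2) := by
    rw [Real.abs_sin_eq_sin_abs_of_abs_le_pi (by rw [habs]; linarith), habs]
  have hle : |(a - b) / 2| ≤ δ := by
    rw [habs]
    by_contra! hlt
    rw [hsin] at hn
    have hlt' : Real.sin (|a - b| / 2) < Real.sin c := by linarith
    rcases le_total (|a - b| / 2) (π / 2) with h2 | h2
    · linarith [Real.sin_le_sin_of_le_of_le_pi_div_two (x := c) (by linarith) h2 (by linarith)]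
    · have := Real.sin_le_sin_of_le_of_le_pi_div_two (x := c) (y := π - |a - b| / 2)
        (by linarith) (by linarith) (by linarith)
      rw [Real.sin_pi_sub] at this
      linarith
  have := h _ hle
  rw [habs] at this
  linarith

/-- The arc explored by a unit-speed agent is at most the elapsed time. -/
theorem volume_explored_le {f : ℝ → Plane} {a b α ℓ : ℝ} (hf : LipschitzOnWith 1 f (Set.Icc a b))
    (hab : a ≤ b) (hℓ : ℓ < 2 * π) :
    volume {θ | θ ∈ Set.Icc α (α + ℓ) ∧ ∃ s ∈ Set.Icc a b, f s = circlePt θ}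
      ≤ ENNReal.ofReal (b - a) := by
  have key : ∀ K : ℝ, 1 < K →
      volume {θ | θ ∈ Set.Icc α (α + ℓ) ∧ ∃ s ∈ Set.Icc a b, f s = circlePt θ}
        ≤ ENNReal.ofReal (K * (b - a)) := by
    intro K hK
    obtain ⟨η, hη, h⟩ := exists_pos_abs_sub_le_mul_norm_circlePt_sub hK hℓ
    obtain ⟨N, hN⟩ := exists_nat_gt ((b - a) / η)
    have hN0 : (0 : ℝ) < N := (div_nonneg (sub_nonneg.2 hab) hη.le).trans_lt hN
    set d := (b - a) / N with hd
    have hdη : d < η := by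
      rw [hd, div_lt_iff₀ hN0]
      rwa [div_lt_iff₀ hη, mul_comm] at hN
    have hd0 : 0 ≤ d := div_nonneg (sub_nonneg.2 hab) hN0.le
    have hNd : N * d = b - a := by rw [hd]; field_simp
    let A : ℕ → Set ℝ := fun k ↦ {θ | θ ∈ Set.Icc α (α + ℓ) ∧
      ∃ s ∈ Set.Icc a b, s ∈ Set.Icc (a + k * d) (a + (k + 1) * d) ∧ f s = circlePt θ}
    have hcover : {θ | θ ∈ Set.Icc α (α + ℓ) ∧ ∃ s ∈ Set.Icc a b, f s = circlePt θ}
        ⊆ ⋃ k ∈ Finset.range N, A k := by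
      rintro θ ⟨hθ, s, hs, hfs⟩
      have hsN : (s - a) / d ≤ N := div_le_of_le_mul₀ hd0 hN0.le (by linarith [hs.2])
      have hceil := Nat.le_ceil ((s - a) / d)
      simp only [Set.mem_iUnion, Finset.mem_range, exists_prop]
      rcases hm : ⌈(s - a) / d⌉₊ with _ | k
      · refine ⟨0, by exact_mod_cast hN0, hθ, s, hs, ?_, hfs⟩
        have hsa : s ≤ a := by
          rcases hd0.eq_or_lt with h0 | h0
          · rw [← h0, mul_zero] at hNd
            linarith [hs.2]
          · rw [hm, div_le_iff₀ h0] at hceil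
            simp only [Nat.cast_zero, zero_mul] at hceil
            linarith
        constructor <;> push_cast <;> linarith [hs.1]
      · have hk : (k : ℝ) < (s - a) / d := Nat.lt_ceil.1 (by omega)
        have hkN : k < N := by exact_mod_cast hk.trans_le hsN
        have h0 : 0 < d := hd0.lt_of_ne fun h0 ↦ by
          rw [← h0, div_zero] at hk
          exact absurd hk (not_lt.2 k.cast_nonneg)
        rw [hm, div_le_iff₀ h0] at hceil
        rw [lt_div_iff₀ h0] at hk
        push_cast at hceil
        exact ⟨k, hkN, hθ, s, hs, ⟨by linarith, by linarith⟩, hfs⟩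
    have hpiece : ∀ k, volume (A k) ≤ ENNReal.ofReal (K * d) := by
      refine fun k ↦ (Real.volume_le_diam _).trans (Metric.ediam_le ?_)
      rintro x ⟨hx, s, hs, hsk, hsx⟩ y ⟨hy, s', hs', hsk', hsy⟩
      rw [edist_dist, Real.dist_eq]
      have hxy : |x - y| ≤ ℓ := by
        rw [abs_le]; constructor <;> linarith [hx.1, hx.2, hy.1, hy.2]
      have hss : |s - s'| ≤ d := by
        rw [abs_le]; constructor <;> linarith [hsk.1, hsk.2, hsk'.1, hsk'.2]
      have hchord : ‖circlePt x - circlePt y‖ ≤ d := by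
        have := hf.dist_le_mul s hs s' hs'
        rw [dist_eq_norm, Real.dist_eq, NNReal.coe_one, one_mul, hsx, hsy] at this
        exact this.trans hss
      exact ENNReal.ofReal_le_ofReal ((h x y hxy (hchord.trans_lt hdη)).trans (by gcongr))
    calc _ ≤ volume (⋃ k ∈ Finset.range N, A k) := measure_mono hcover
      _ ≤ ∑ k ∈ Finset.range N, volume (A k) := measure_biUnion_finset_le _ _
      _ ≤ ∑ k ∈ Finset.range N, ENNReal.ofReal (K * d) := Finset.sum_le_sum fun k _ ↦ hpiece k
      _ = ENNReal.ofReal (K * (b - a)) := by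
        rw [Finset.sum_const, Finset.card_range, ← ENNReal.ofReal_nsmul, nsmul_eq_mul, ← hNd]
        congr 1
        ring
  have hlim : Filter.Tendsto (fun K : ℝ ↦ ENNReal.ofReal (K * (b - a)))
      (nhdsWithin 1 (Set.Ioi 1)) (nhds (ENNReal.ofReal (1 * (b - a)))) :=
    (ENNReal.tendsto_ofReal ((continuous_id.mul continuous_const).tendsto 1)).mono_left
      nhdsWithin_le_nhds
  rw [one_mul] at hlim
  exact ge_of_tendsto hlim (by filter_upwards [self_mem_nhdsWithin] with K hK using key K hK)

theorem IsTraj.norm_sub_le {f : ℝ → Plane} (hf : IsTraj f) {s t : ℝ} (hs : 0 ≤ s) (hst : s ≤ t) :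
    ‖f s - f t‖ ≤ t - s := by
  have := hf.1.dist_le_mul s hs t (hs.trans hst)
  rw [dist_eq_norm, Real.dist_eq, abs_sub_comm, abs_of_nonneg (sub_nonneg.2 hst)] at this
  simpa using this

theorem IsTraj.one_le_of_norm_eq_one {f : ℝ → Plane} (hf : IsTraj f) {s : ℝ} (hs : 0 ≤ s)
    (h : ‖f s‖ = 1) : 1 ≤ s := by
  have := hf.norm_sub_le le_rfl hs
  rw [hf.2, zero_sub, norm_neg, h] at this
  linarith

theorem Evacuates.visited_or_norm_sub_le {n : ℕ} {Q : ℝ → Plane} {S : Fin n → ℝ → Plane} {B : ℝ}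
    (hB : Evacuates Q S B) (hQ : IsTraj Q) {t : ℝ} (ht : 0 ≤ t) {p : Plane} (hp : ‖p‖ = 1) :
    (∃ s ∈ Set.Icc 0 t, Q s = p ∨ ∃ i, S i s = p) ∨ ‖Q t - p‖ ≤ B - t := by
  by_contra! hcon
  obtain ⟨hnot, hlt⟩ := hcon
  obtain ⟨hex, hle⟩ := hB p hp
  have htp : t ≤ visitTime Q S p := by
    refine le_csInf hex ?_
    rintro s ⟨hs0, hs⟩
    by_contra! hst
    rcases hs with hs | ⟨i, hi⟩
    · exact (hnot s ⟨hs0, hst.le⟩).1 hs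
    · exact (hnot s ⟨hs0, hst.le⟩).2 i hi
  have h1 := hQ.norm_sub_le ht htp
  have h2 := norm_sub_le_norm_sub_add_norm_sub (Q t) (Q (visitTime Q S p)) p
  linarith

theorem two_cos_sub_two_cos_le {x y : ℝ} (hxy : x ≤ y) :
    2 * Real.cos x - 2 * Real.cos y ≤ 2 * (y - x) := by
  have := (le_abs_self _).trans (Real.abs_cos_sub_cos_le x y)
  rw [abs_sub_comm, abs_of_nonneg (sub_nonneg.2 hxy)] at this
  linarith

theorem exists_gt_lt_two_cos {r ψ m : ℝ} (hr : r < 2 * Real.cos ψ) (hm : ψ < m) :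
    ∃ ψ', ψ < ψ' ∧ ψ' < m ∧ r < 2 * Real.cos ψ' := by
  have hc : ContinuousAt (fun x ↦ 2 * Real.cos x) ψ := by fun_prop
  have h := (hc.eventually_const_lt hr).filter_mono (nhdsWithin_le_nhds (s := Set.Ioi ψ))
  obtain ⟨x, ⟨hx, hxm⟩, hxψ⟩ := (((h.and (Filter.Eventually.filter_mono nhdsWithin_le_nhds
    (eventually_lt_nhds hm))).and self_mem_nhdsWithin)).exists
  exact ⟨x, hxψ, hxm, hx⟩

/-- If every point of an arc of length `ℓ` is explored by one of two servants during `[1, t]`, or by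
the queen during `[1, τ]` or at time `t`, then `ℓ ≤ 2 (t - 1) + (τ - 1)`. -/
theorem arc_le_of_explored {Q : ℝ → Plane} {S : Fin 2 → ℝ → Plane} (hQ : IsTraj Q)
    (hS : ∀ i, IsTraj (S i)) {t τ α ℓ : ℝ} (ht : 1 ≤ t) (hτ : 1 ≤ τ) (hℓ : ℓ < 2 * π)
    (h : ∀ θ ∈ Set.Icc α (α + ℓ), (∃ i, ∃ s ∈ Set.Icc 1 t, S i s = circlePt θ) ∨
      (∃ s ∈ Set.Icc 1 τ, Q s = circlePt θ) ∨ Q t = circlePt θ) :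
    ℓ ≤ 2 * (t - 1) + (τ - 1) := by
  have hlip : ∀ {f : ℝ → Plane} {a b : ℝ}, IsTraj f → 0 ≤ a → LipschitzOnWith 1 f (Set.Icc a b) :=
    fun hf ha ↦ hf.1.mono fun x hx ↦ ha.trans hx.1
  let E (f : ℝ → Plane) (a b : ℝ) : Set ℝ :=
    {θ | θ ∈ Set.Icc α (α + ℓ) ∧ ∃ s ∈ Set.Icc a b, f s = circlePt θ}
  have hE : ∀ {f : ℝ → Plane} {a b : ℝ}, IsTraj f → 0 ≤ a → a ≤ b →
      volume (E f a b) ≤ ENNReal.ofReal (b - a) :=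
    fun hf ha hab ↦ volume_explored_le (hlip hf ha) hab hℓ
  have hsub : Set.Icc α (α + ℓ) ⊆ (E (S 0) 1 t ∪ E (S 1) 1 t) ∪ (E Q 1 τ ∪ E Q t t) := by
    intro θ hθ
    rcases h θ hθ with ⟨i, s, hs, hp⟩ | ⟨s, hs, hp⟩ | hp
    · fin_cases i
      · exact Or.inl (Or.inl ⟨hθ, s, hs, hp⟩)
      · exact Or.inl (Or.inr ⟨hθ, s, hs, hp⟩)
    · exact Or.inr (Or.inl ⟨hθ, s, hs, hp⟩)
    · exact Or.inr (Or.inr ⟨hθ, t, ⟨le_rfl, le_rfl⟩, hp⟩)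
  have hvol := calc
    ENNReal.ofReal ℓ = volume (Set.Icc α (α + ℓ)) := by rw [Real.volume_Icc, add_sub_cancel_left]
    _ ≤ (volume (E (S 0) 1 t) + volume (E (S 1) 1 t)) + (volume (E Q 1 τ) + volume (E Q t t)) :=
      (measure_mono hsub).trans ((measure_union_le _ _).trans
        (add_le_add (measure_union_le _ _) (measure_union_le _ _)))
    _ ≤ (ENNReal.ofReal (t - 1) + ENNReal.ofReal (t - 1)) +
        (ENNReal.ofReal (τ - 1) + ENNReal.ofReal (t - t)) := by
      gcongr
      · exact hE (hS 0) zero_le_one ht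
      · exact hE (hS 1) zero_le_one ht
      · exact hE hQ zero_le_one hτ
      · exact hE hQ (zero_le_one.trans ht) le_rfl
    _ = ENNReal.ofReal (2 * (t - 1) + (τ - 1)) := by
      rw [← ENNReal.ofReal_add (by linarith) (by linarith),
        ← ENNReal.ofReal_add (by linarith) (by linarith),
        ← ENNReal.ofReal_add (by linarith) (by linarith)]
      congr 1
      ring
  exact (ENNReal.ofReal_le_ofReal_iff (by linarith)).1 hvol

/-- If by time `t` all points of the circle at distance more than `r` from `circlePt α` are explored,
by two servants and by a queen exploring only during `[1, τ]` or at time `t`, then `r` is at least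
the chord cutting off a far arc of length `2 (t - 1) + (τ - 1)`. -/
theorem le_of_explored_far {Q : ℝ → Plane} {S : Fin 2 → ℝ → Plane} (hQ : IsTraj Q)
    (hS : ∀ i, IsTraj (S i)) {t τ α r : ℝ} (ht : 1 ≤ t) (hτ : 1 ≤ τ)
    (hψ : (2 * (t - 1) + (τ - 1)) / 4 < π / 2)
    (h : ∀ p : Plane, ‖p‖ = 1 → r < ‖circlePt α - p‖ → (∃ i, ∃ s ∈ Set.Icc 1 t, S i s = p) ∨
      (∃ s ∈ Set.Icc 1 τ, Q s = p) ∨ Q t = p) :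
    2 * Real.cos ((2 * (t - 1) + (τ - 1)) / 4) ≤ r := by
  by_contra! hr
  obtain ⟨ψ, h1, h2, h3⟩ := exists_gt_lt_two_cos hr hψ
  have hψ0 : 0 < ψ := by linarith
  have := arc_le_of_explored (α := α + π - 2 * ψ) (ℓ := 4 * ψ) hQ hS ht hτ (by linarith) (by
    intro θ hθ
    refine h _ (norm_circlePt θ) (h3.trans_le ?_)
    have hx : |(α - θ) / 2 + π / 2| ≤ ψ := by
      rw [abs_le]; constructor <;> linarith [hθ.1, hθ.2]
    have hc : Real.cos ψ ≤ Real.cos ((α - θ) / 2 + π / 2) := by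
      rw [← Real.cos_abs ((α - θ) / 2 + π / 2)]
      exact Real.cos_le_cos_of_nonneg_of_le_pi (abs_nonneg _) (by linarith [Real.pi_pos]) hx
    rw [Real.cos_add_pi_div_two] at hc
    rw [norm_circlePt_sub]
    linarith [neg_le_abs (Real.sin ((α - θ) / 2))])
  linarith

/-- with two servants, any evacuation of the queen takes time at least
`T₂ ≈ 3.6307`, where `T₂` is defined by the stated system of equations. -/
theorem priority_evacuation_two_servants_lower_bound
    (τ tstar T₂ : ℝ)
    (hτ : 1 < τ) (hτ' : τ < 2) (hts : 2 < tstar) (hts' : tstar < 3)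
    (hT : 3 < T₂) (hT' : T₂ < 4)
    (e1 : τ = T₂ - 2 * Real.cos ((τ - 1) / 2))
    (e2 : tstar = (T₂ + 1) / 2)
    (e3 : T₂ = tstar + 2 * Real.cos ((2 * tstar + τ) / 4 - 3 / 4))
    (Q : ℝ → Plane) (S : Fin 2 → ℝ → Plane)
    (hQ : IsTraj Q) (hS : ∀ i, IsTraj (S i))
    (B : ℝ) (hB : Evacuates Q S B) :
    T₂ ≤ B := by
  by_contra! hBT
  have hQvis : ∀ s, τ ≤ s → s < tstar → ‖Q s‖ ≠ 1 := by
    intro t ht1 ht2 hn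
    obtain ⟨α, hα⟩ := exists_eq_circlePt hn
    have := le_of_explored_far (α := α) (r := max (B - t) (t - 1)) (t := t) (τ := 1) hQ hS
      (by linarith) le_rfl (by linarith [Real.pi_gt_three]) (by
        intro p hp hr
        rw [← hα, max_lt_iff] at hr
        rcases hB.visited_or_norm_sub_le hQ (t := t) (by linarith) hp with ⟨s, hs, hv⟩ | hle
        · rcases hv with hv | ⟨i, hi⟩
          · have h1 := hQ.one_le_of_norm_eq_one hs.1 (by rw [hv, hp])
            have h2 := hQ.norm_sub_le hs.1 hs.2
            rw [norm_sub_rev, hv] at h2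
            linarith [hr.2]
          · exact Or.inl ⟨i, s, ⟨(hS i).one_le_of_norm_eq_one hs.1 (by rw [hi, hp]), hs.2⟩, hi⟩
        · linarith [hr.1])
    have hmono := two_cos_sub_two_cos_le (x := (τ - 1) / 2) (y := (t - 1) / 2) (by linarith)
    rw [show (2 * (t - 1) + (1 - 1)) / 4 = (t - 1) / 2 by ring] at this
    rcases le_max_iff.1 this with h | h <;> linarith
  have hfar : ∀ t, tstar ≤ t → T₂ ≤ t + 2 * Real.cos ((2 * (t - 1) + (τ - 1)) / 4) := by
    intro t ht
    have := two_cos_sub_two_cos_le (x := (2 * tstar + τ) / 4 - 3 / 4)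
      (y := (2 * (t - 1) + (τ - 1)) / 4) (by linarith)
    linarith
  have hangle : (2 * (T₂ - 1) + (τ - 1)) / 4 ≤ π / 2 := by
    by_contra! hlt
    have := Real.cos_neg_of_pi_div_two_lt_of_lt hlt (by linarith [Real.pi_gt_three])
    linarith [hfar T₂ (by linarith)]
  have hB1 : 1 ≤ B := by
    rcases hB.visited_or_norm_sub_le hQ le_rfl (norm_circlePt 0) with ⟨s, hs, hv⟩ | hle
    · rcases hv with hv | ⟨i, hi⟩
      · linarith [hQ.one_le_of_norm_eq_one hs.1 (by rw [hv, norm_circlePt]), hs.2]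
      · linarith [(hS i).one_le_of_norm_eq_one hs.1 (by rw [hi, norm_circlePt]), hs.2]
    · rw [hQ.2, zero_sub, norm_neg, norm_circlePt] at hle
      linarith
  by_cases hC : (Set.Icc tstar B ∩ {s | ‖Q s‖ = 1}).Nonempty
  · have hcont : ContinuousOn (fun s ↦ ‖Q s‖) (Set.Icc tstar B) :=
      (hQ.1.continuousOn.mono fun x hx ↦ by
        rw [Set.mem_Ici]; linarith [hx.1]).norm
    have hcomp : IsCompact (Set.Icc tstar B ∩ {s | ‖Q s‖ = 1}) :=
      isCompact_Icc.of_isClosed_subset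
        (hcont.preimage_isClosed_of_isClosed isClosed_Icc isClosed_singleton)
        Set.inter_subset_left
    obtain ⟨t, ⟨ht, hn⟩, hleast⟩ := hcomp.exists_isLeast hC
    obtain ⟨α, hα⟩ := exists_eq_circlePt hn
    have := le_of_explored_far (α := α) (r := B - t) (t := t) (τ := τ) hQ hS
      (by linarith [ht.1]) hτ.le (by linarith [ht.2]) (by
        intro p hp hr
        rw [← hα] at hr
        rcases hB.visited_or_norm_sub_le hQ (t := t) (by linarith [ht.1]) hp with ⟨s, hs, hv⟩ | hle
        · rcases hv with hv | ⟨i, hi⟩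
          · have hn' : ‖Q s‖ = 1 := by rw [hv, hp]
            right
            rcases le_or_gt s τ with hsτ | hsτ
            · exact Or.inl ⟨s, ⟨hQ.one_le_of_norm_eq_one hs.1 hn', hsτ⟩, hv⟩
            · have hst : tstar ≤ s := by
                by_contra! hlt
                exact hQvis s hsτ.le hlt hn'
              rw [le_antisymm (hleast ⟨⟨hst, hs.2.trans ht.2⟩, hn'⟩) hs.2]
              exact Or.inr hv
          · exact Or.inl ⟨i, s, ⟨(hS i).one_le_of_norm_eq_one hs.1 (by rw [hi, hp]), hs.2⟩, hi⟩
        · linarith)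
    linarith [hfar t ht.1]
  · obtain ⟨ℓ, hℓ1, hℓ2⟩ := exists_between
      (show 2 * (B - 1) + (τ - 1) < 2 * π by linarith)
    have := arc_le_of_explored (t := B) (τ := τ) (α := 0) hQ hS hB1 hτ.le hℓ2 (by
      intro θ _
      rcases hB.visited_or_norm_sub_le hQ (t := B) (by linarith) (norm_circlePt θ) with
        ⟨s, hs, hv⟩ | hle
      · rcases hv with hv | ⟨i, hi⟩
        · have hn' : ‖Q s‖ = 1 := by rw [hv, norm_circlePt]
          right; left
          refine ⟨s, ⟨hQ.one_le_of_norm_eq_one hs.1 hn', ?_⟩, hv⟩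
          by_contra! hsτ
          have hst : tstar ≤ s := by
            by_contra! hlt
            exact hQvis s hsτ.le hlt hn'
          exact hC ⟨s, ⟨hst, hs.2⟩, hn'⟩
        · exact Or.inl ⟨i, s, ⟨(hS i).one_le_of_norm_eq_one hs.1
            (by rw [hi, norm_circlePt]), hs.2⟩, hi⟩
      · rw [sub_self] at hle
        exact Or.inr (Or.inr (sub_eq_zero.1 (norm_le_zero_iff.1 hle))))
    linarith
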